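/- arXiv:2009.01742 — 4 statements merged into one kernel-verified Lean document; each statement's English description precedes it below -/
import Mathlib

section
/- Let m ≥ 1, K ≥ 2, fix z* : Fin m → Fin K, and let L : (Fin m → Fin K) → ℝ be nonnegative with L(z) ≤ L(z*) · exp(−a · d_H(z, z*)) for every z, where a > 0. If m(K−1) e^{−a} ≤ 1/2, then ∑_{z ≠ z*} L(z) ≤ 2 m (K−1) e^{−a} · L(z*). -/
open Finset Real

lemma aux_pow (t : ℝ) (ht : 0 ≤ t) (n : ℕ) (h : (n : ℝ) * t ≤ 1 / 2) :
    (1 + t) ^ n ≤ 1 + 2 * n * t := by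
  induction n with
  | zero => simp
  | succ k ih =>
    push_cast at h ⊢
    have h1 : (k : ℝ) * t ≤ 1 / 2 := by nlinarith
    have h2 := ih h1
    rw [pow_succ]
    have h3 : (1 + t) ^ k * (1 + t) ≤ (1 + 2 * k * t) * (1 + t) :=
      mul_le_mul_of_nonneg_right h2 (by linarith)
    nlinarith [mul_le_mul_of_nonneg_right h1 ht]

lemma aux_sum (m K : ℕ) (zs : Fin m → Fin K) (x : ℝ) :
    ∑ z : Fin m → Fin K, x ^ hammingDist z zs = (1 + ((K : ℝ) - 1) * x) ^ m := by
  have h1 : ∀ z : Fin m → Fin K,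
      x ^ hammingDist z zs = ∏ i, (if z i = zs i then 1 else x) := by
    intro z
    rw [Finset.prod_ite]
    simp [hammingDist]
  have h2 : ∀ i, ∑ k : Fin K, (if k = zs i then 1 else x) = 1 + ((K : ℝ) - 1) * x := by
    intro i
    have : ∀ k : Fin K, (if k = zs i then 1 else x) = x + (if k = zs i then 1 - x else 0) := by
      intro k
      split_ifs <;> ring
    simp only [this, Finset.sum_add_distrib]
    simp
    ring
  have h3 := Finset.prod_univ_sum (fun _ : Fin m => (Finset.univ : Finset (Fin K)))
    (fun i k => if k = zs i then 1 else x)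
  simp only [h2, Fintype.piFinset_univ] at h3
  simp only [h1]
  rw [← h3]
  simp

/-- Deterministic core of the paper's Lemma 2: if the nonnegative likelihood `L` decays
exponentially in the Hamming distance from the true assignment `z*`, i.e.
`L z ≤ L z* * exp (-a * d_H(z, z*))` with `a > 0`, and `m (K-1) e^{-a} ≤ 1/2`, then the
total mass on incorrect assignments satisfies
`∑_{z ≠ z*} L z ≤ 2 m (K-1) e^{-a} L z*`. -/
theorem stmt_6 (m K : ℕ) (hm : 1 ≤ m) (hK : 2 ≤ K) (zstar : Fin m → Fin K)
    (L : (Fin m → Fin K) → ℝ) (hL0 : ∀ z, 0 ≤ L z) (a : ℝ) (ha : 0 < a)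
    (hdecay : ∀ z, L z ≤ L zstar * Real.exp (-a * (hammingDist z zstar : ℝ)))
    (hsmall : (m : ℝ) * ((K : ℝ) - 1) * Real.exp (-a) ≤ 1 / 2) :
    ∑ z ∈ Finset.univ.filter (fun z : Fin m → Fin K => z ≠ zstar), L z
      ≤ 2 * (m : ℝ) * ((K : ℝ) - 1) * Real.exp (-a) * L zstar := by
  have hK' : (0 : ℝ) ≤ (K : ℝ) - 1 := by
    have : (2 : ℝ) ≤ K := by exact_mod_cast hK
    linarith
  have hp := aux_pow (((K : ℝ) - 1) * Real.exp (-a))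
    (mul_nonneg hK' (Real.exp_pos _).le) m (by linarith)
  rw [← aux_sum m K zstar, ← Finset.add_sum_erase _ _ (Finset.mem_univ zstar)] at hp
  rw [hammingDist_self, pow_zero] at hp
  rw [Finset.filter_ne']
  calc ∑ z ∈ Finset.univ.erase zstar, L z
      ≤ ∑ z ∈ Finset.univ.erase zstar, L zstar * Real.exp (-a) ^ hammingDist z zstar := by
        refine Finset.sum_le_sum fun z _ => ?_
        rw [← Real.exp_nat_mul, mul_comm (_ : ℝ) (-a)]
        exact hdecay z
    _ = L zstar * ∑ z ∈ Finset.univ.erase zstar, Real.exp (-a) ^ hammingDist z zstar := by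
        rw [Finset.mul_sum]
    _ ≤ L zstar * (2 * m * (((K : ℝ) - 1) * Real.exp (-a))) :=
        mul_le_mul_of_nonneg_left (by linarith) (hL0 zstar)
    _ = _ := by ring
end

section
/- Let K ≥ 2, let π ∈ ℝ^K have strictly positive entries, fix k* ∈ {1, …, K}, let γ > 0, n ≥ 1, and let a_1, …, a_n : {1, …, K} → ℝ satisfy a_w(k) ≤ a_w(k*) − γ for every w ∈ {1, …, n} and every k ≠ k*. Define τ ∈ Δ_K by τ_k = π_k exp(∑_{w=1}^n a_w(k)) / ∑_{l=1}^K π_l exp(∑_{w=1}^n a_w(l)). Then 1 − τ_{k*} = ∑_{k ≠ k*} τ_k ≤ e^{−nγ} · (∑_{k ≠ k*} π_k) / π_{k*}. -/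
open Finset Real

/-- Evidence-accumulation mechanism (Step 1 of the proof of Theorem 2 / Lemma 4): if in
each of `n` windows the evidence `a w k` for every wrong class `k ≠ k*` falls below that of
the true class `k*` by a margin `γ > 0`, then the softmax posterior
`τ k = p k exp(∑ w, a w k) / ∑ l, p l exp(∑ w, a w l)` concentrates on `k*`:
`1 - τ k* = ∑_{k ≠ k*} τ k ≤ e^{-nγ} (∑_{k ≠ k*} p k) / p k*`. -/
theorem stmt_11 (K : ℕ) (hK : 2 ≤ K) (p : Fin K → ℝ) (hp : ∀ k, 0 < p k)
    (kstar : Fin K) (γ : ℝ) (hγ : 0 < γ) (n : ℕ) (hn : 1 ≤ n)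
    (a : Fin n → Fin K → ℝ)
    (hmargin : ∀ w : Fin n, ∀ k : Fin K, k ≠ kstar → a w k ≤ a w kstar - γ) :
    let τ : Fin K → ℝ := fun k =>
      p k * Real.exp (∑ w, a w k) / ∑ l, p l * Real.exp (∑ w, a w l)
    1 - τ kstar = ∑ k ∈ Finset.univ.filter (fun k => k ≠ kstar), τ k ∧
      ∑ k ∈ Finset.univ.filter (fun k => k ≠ kstar), τ k
        ≤ Real.exp (-(n : ℝ) * γ) *
            (∑ k ∈ Finset.univ.filter (fun k => k ≠ kstar), p k) / p kstar := by
  intro τ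
  have hpos : ∀ k, 0 < p k * Real.exp (∑ w, a w k) := fun k =>
    mul_pos (hp k) (Real.exp_pos _)
  have hle : p kstar * Real.exp (∑ w, a w kstar) ≤ ∑ l, p l * Real.exp (∑ w, a w l) :=
    Finset.single_le_sum (f := fun l => p l * Real.exp (∑ w, a w l))
      (fun l _ => (hpos l).le) (Finset.mem_univ kstar)
  have hZ : 0 < ∑ l, p l * Real.exp (∑ w, a w l) := lt_of_lt_of_le (hpos kstar) hle
  have hsum : ∑ k, τ k = 1 := by
    simp only [τ]
    rw [← Finset.sum_div]
    exact div_self hZ.ne'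
  constructor
  · rw [← hsum, Finset.filter_ne', ← Finset.add_sum_erase _ τ (Finset.mem_univ kstar)]
    ring
  · rw [Finset.mul_sum, Finset.sum_div]
    apply Finset.sum_le_sum
    intro k hk
    have hk' : k ≠ kstar := (Finset.mem_filter.mp hk).2
    have h1 : ∑ w, a w k ≤ -(n : ℝ) * γ + ∑ w, a w kstar := by
      have h := Finset.sum_le_sum (s := Finset.univ) (fun w _ => hmargin w k hk')
      simp only [Finset.sum_sub_distrib, Finset.sum_const, Finset.card_univ,
        Fintype.card_fin, nsmul_eq_mul] at h
      linarith
    have h2 := Real.exp_le_exp.mpr h1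
    rw [Real.exp_add] at h2
    calc τ k ≤ p k * Real.exp (∑ w, a w k) / (p kstar * Real.exp (∑ w, a w kstar)) :=
          div_le_div_of_nonneg_left (hpos k).le (hpos kstar) hle
      _ ≤ p k * (Real.exp (-(n : ℝ) * γ) * Real.exp (∑ w, a w kstar)) /
            (p kstar * Real.exp (∑ w, a w kstar)) :=
          div_le_div_of_nonneg_right (mul_le_mul_of_nonneg_left h2 (hp k).le) (hpos kstar).le
      _ = Real.exp (-(n : ℝ) * γ) * p k / p kstar := by
          have := (hp kstar).ne'
          have := (Real.exp_pos (∑ w, a w kstar)).ne'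
          rw [← mul_assoc, mul_div_mul_right _ _ this, mul_comm (p k)]
end

section
/- Let c > 0, n ≥ 1, and 0 ≤ h < n. Let (η_t)_{0≤t≤n} satisfy 0 < η_t ≤ 1/c, and let (b_t)_{0≤t≤n} be nonnegative and nonincreasing. Then ∑_{t=0}^n η_t b_t ∏_{s=t+1}^n (1 − c η_s) ≤ ( ∏_{s=h+1}^n (1 − c η_s) ) · ∑_{t=0}^{h} η_t b_t + b_{h+1} / c, where an empty product equals 1. -/
open Finset

/-- Split-sum estimate (key computation in the proof of Theorem 3): for `c > 0`,
`0 ≤ h < n`, step sizes `0 < η t ≤ 1/c` and nonnegative nonincreasing weights `b t`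
(for `t ≤ n`),
`∑_{t=0}^n η t b t ∏_{s=t+1}^n (1 - c η s)
  ≤ (∏_{s=h+1}^n (1 - c η s)) ∑_{t=0}^h η t b t + b (h+1) / c`. -/
theorem stmt_15 (c : ℝ) (hc : 0 < c) (n h : ℕ) (hn : 1 ≤ n) (hhn : h < n)
    (η b : ℕ → ℝ)
    (hη : ∀ t ≤ n, 0 < η t ∧ η t ≤ 1 / c)
    (hb0 : ∀ t ≤ n, 0 ≤ b t)
    (hbmono : ∀ s t : ℕ, s ≤ t → t ≤ n → b t ≤ b s) :
    ∑ t ∈ Finset.range (n + 1), η t * b t * ∏ s ∈ Finset.Icc (t + 1) n, (1 - c * η s)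
      ≤ (∏ s ∈ Finset.Icc (h + 1) n, (1 - c * η s)) *
          ∑ t ∈ Finset.range (h + 1), η t * b t
        + b (h + 1) / c := by
  have hq : ∀ t ≤ n, 0 ≤ 1 - c * η t ∧ 1 - c * η t ≤ 1 := by
    intro t ht
    obtain ⟨h1, h2⟩ := hη t ht
    have h3 : η t * c ≤ 1 := (le_div_iff₀ hc).1 h2
    have h4 := mul_pos hc h1
    constructor <;> linarith
  have hB : 0 ≤ b (h + 1) := hb0 _ hhn
  have key : ∀ m, h ≤ m → m ≤ n →
      ∑ t ∈ Finset.range (m + 1), η t * b t * ∏ s ∈ Finset.Icc (t + 1) m, (1 - c * η s)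
      ≤ (∏ s ∈ Finset.Icc (h + 1) m, (1 - c * η s)) *
          ∑ t ∈ Finset.range (h + 1), η t * b t
        + b (h + 1) / c := by
    intro m hm
    induction m, hm using Nat.le_induction with
    | base =>
      intro hmn
      have h1 : ∑ t ∈ Finset.range (h + 1),
          η t * b t * ∏ s ∈ Finset.Icc (t + 1) h, (1 - c * η s)
          ≤ ∑ t ∈ Finset.range (h + 1), η t * b t := by
        apply Finset.sum_le_sum
        intro t ht
        have ht' : t ≤ n := by
          have := Finset.mem_range.1 ht
          omega
        apply mul_le_of_le_one_right (mul_nonneg (hη t ht').1.le (hb0 t ht'))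
        apply Finset.prod_le_one
        · intro s hs
          exact (hq s (by have := Finset.mem_Icc.1 hs; omega)).1
        · intro s hs
          exact (hq s (by have := Finset.mem_Icc.1 hs; omega)).2
      have h2 : 0 ≤ b (h + 1) / c := div_nonneg hB hc.le
      have h3 : Finset.Icc (h + 1) h = ∅ := Finset.Icc_eq_empty (by omega)
      rw [h3, Finset.prod_empty, one_mul]
      linarith
    | succ m hm ih =>
      intro hmn
      have ih' := ih (by omega)
      have hrec : ∑ t ∈ Finset.range (m + 1),
          η t * b t * ∏ s ∈ Finset.Icc (t + 1) (m + 1), (1 - c * η s)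
          = (∑ t ∈ Finset.range (m + 1),
            η t * b t * ∏ s ∈ Finset.Icc (t + 1) m, (1 - c * η s)) * (1 - c * η (m + 1)) := by
        rw [Finset.sum_mul]
        apply Finset.sum_congr rfl
        intro t ht
        have := Finset.mem_range.1 ht
        rw [Finset.prod_Icc_succ_top (by omega), mul_assoc (η t * b t)]
      have he : Finset.Icc (m + 1 + 1) (m + 1) = ∅ := Finset.Icc_eq_empty (by omega)
      rw [Finset.sum_range_succ, hrec, he, Finset.prod_empty, mul_one,
        Finset.prod_Icc_succ_top (by omega)]
      have h1 := mul_le_mul_of_nonneg_right ih' (hq (m + 1) hmn).1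
      have h2 := mul_le_mul_of_nonneg_left (hbmono (h + 1) (m + 1) (by omega) hmn)
        (hη (m + 1) hmn).1.le
      have h3 : b (h + 1) / c * (1 - c * η (m + 1))
          = b (h + 1) / c - η (m + 1) * b (h + 1) := by
        field_simp
      rw [add_mul, h3] at h1
      linarith
  exact key n hhn.le le_rfl
end

section
/- Let 0 < α < 1, 0 < c ≤ 1, B ≥ 0, L ≥ 0, x ≥ 0, and let (a_n)_{n≥0} be a sequence of nonnegative reals satisfying a_{n+1} ≤ (1 − c(n+1)^{−α}) a_n + B( (n+1)^{−2α} L + (n+1)^{−α} x ) for all n ≥ 0. Then there exists a constant C > 0, depending only on α, c and B, such that for all n ≥ 1, a_n ≤ C ( (a_0 + L) n^{−α} + x ). -/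
open Real

set_option maxHeartbeats 2000000

/-- Deterministic core of Theorem 3: if a nonnegative sequence satisfies
`a (n+1) ≤ (1 - c (n+1)^{-α}) a n + B ((n+1)^{-2α} L + (n+1)^{-α} x)` with step sizes
`η n = (n+1)^{-α}`, `0 < α < 1`, `0 < c ≤ 1`, `B ≥ 0`, then there is a constant `C > 0`,
depending only on `α`, `c` and `B`, such that `a n ≤ C ((a 0 + L) n^{-α} + x)` for `n ≥ 1`. -/
theorem stmt_18 (α c B : ℝ) (hα0 : 0 < α) (hα1 : α < 1) (hc0 : 0 < c) (hc1 : c ≤ 1)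
    (hB : 0 ≤ B) :
    ∃ C > 0, ∀ (L x : ℝ), 0 ≤ L → 0 ≤ x → ∀ a : ℕ → ℝ, (∀ n, 0 ≤ a n) →
      (∀ n : ℕ, a (n + 1)
          ≤ (1 - c * ((n : ℝ) + 1) ^ (-α)) * a n
            + B * (((n : ℝ) + 1) ^ (-(2 * α)) * L + ((n : ℝ) + 1) ^ (-α) * x)) →
      ∀ n : ℕ, 1 ≤ n → a n ≤ C * ((a 0 + L) * (n : ℝ) ^ (-α) + x) := by
  obtain ⟨N, hN1, hN⟩ : ∃ N : ℕ, 1 ≤ N ∧ ∀ n : ℕ, N ≤ n → 2 / c ≤ (n : ℝ) ^ (1 - α) := by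
    have h := ((tendsto_rpow_atTop (y := 1 - α) (by linarith)).comp
      tendsto_natCast_atTop_atTop (α := ℕ)).eventually_ge_atTop (2 / c)
    obtain ⟨M, hM⟩ := Filter.eventually_atTop.1 h
    exact ⟨max M 1, le_max_right _ _, fun n hn => hM n (le_trans (le_max_left _ _) hn)⟩
  have hNr : (1 : ℝ) ≤ N := by exact_mod_cast hN1
  have hP1 : (1 : ℝ) ≤ (N : ℝ) ^ α := Real.one_le_rpow hNr hα0.le
  have hD0 : 0 ≤ (N : ℝ) * B := by positivity
  set K : ℝ := 2 * B / c + (1 + N * B) * (N : ℝ) ^ α with hK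
  have hBc : 0 ≤ 2 * B / c := by positivity
  have hD1 : 0 < (1 + N * B) * (N : ℝ) ^ α := by positivity
  have hK0 : 0 < K := by linarith
  have hKc : 2 * B ≤ K * c := by
    have h1 : 2 * B / c ≤ K := by linarith
    rwa [div_le_iff₀ hc0] at h1
  refine ⟨K, hK0, ?_⟩
  intro L x hL hx a ha hrec
  have ha0 := ha 0
  have hv : ∀ n : ℕ, 0 < ((n : ℝ) + 1) ^ (-α) ∧ ((n : ℝ) + 1) ^ (-α) ≤ 1 ∧
      ((n : ℝ) + 1) ^ (-(2 * α)) = (((n : ℝ) + 1) ^ (-α)) ^ 2 := by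
    intro n
    have hn : (0 : ℝ) ≤ n := n.cast_nonneg
    refine ⟨by positivity, Real.rpow_le_one_of_one_le_of_nonpos (by linarith) (by linarith), ?_⟩
    rw [← Real.rpow_natCast, ← Real.rpow_mul (by positivity)]
    congr 1
    push_cast
    ring
  have crude : ∀ n : ℕ, a n ≤ a 0 + n * (B * (L + x)) := by
    intro n
    induction n with
    | zero => simp
    | succ n ih =>
      obtain ⟨h0, h1, h2⟩ := hv n
      have h := hrec n
      rw [h2] at h
      set v := ((n : ℝ) + 1) ^ (-α)
      have e1 : 0 ≤ c * v * a n := mul_nonneg (by positivity) (ha n)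
      have e2 : v ^ 2 * L + v * x ≤ L + x := by
        have : v ^ 2 ≤ 1 := by nlinarith
        nlinarith
      have e3 := mul_le_mul_of_nonneg_left e2 hB
      push_cast
      linarith
  have small : ∀ n : ℕ, 1 ≤ n → n ≤ N → a n ≤ K * ((a 0 + L) * (n : ℝ) ^ (-α) + x) := by
    intro n hn hnN
    have hn' : (1 : ℝ) ≤ n := by exact_mod_cast hn
    have hnN' : (n : ℝ) ≤ N := by exact_mod_cast hnN
    have hu : 0 < (n : ℝ) ^ (-α) := by positivity
    have hu1 : 1 ≤ (N : ℝ) ^ α * (n : ℝ) ^ (-α) := by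
      have h1 : (n : ℝ) ^ α ≤ (N : ℝ) ^ α := Real.rpow_le_rpow (by linarith) hnN' hα0.le
      have h2 : (n : ℝ) ^ α * (n : ℝ) ^ (-α) = 1 := by
        rw [← Real.rpow_add (by linarith)]; simp
      rw [← h2]
      exact mul_le_mul_of_nonneg_right h1 hu.le
    have e0 : a n ≤ a 0 + N * (B * (L + x)) := (crude n).trans (by gcongr)
    have e1 : a 0 + N * (B * (L + x)) ≤ (1 + N * B) * ((a 0 + L) + x) := by
      nlinarith [mul_nonneg hD0 ha0]
    have e2 : (a 0 + L) + x ≤ (N : ℝ) ^ α * ((a 0 + L) * (n : ℝ) ^ (-α) + x) := by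
      have f1 := mul_le_mul_of_nonneg_left hu1 (add_nonneg ha0 hL)
      have f2 := mul_le_mul_of_nonneg_right hP1 hx
      linarith
    have e3 := mul_le_mul_of_nonneg_left e2 (by linarith : 0 ≤ 1 + (N : ℝ) * B)
    have e4 : 0 ≤ 2 * B / c * ((a 0 + L) * (n : ℝ) ^ (-α) + x) := by positivity
    rw [hK]
    linarith
  have big : ∀ n : ℕ, N ≤ n → a n ≤ K * ((a 0 + L) * (n : ℝ) ^ (-α) + x) := by
    intro n hn
    induction n, hn using Nat.le_induction with
    | base => exact small N hN1 le_rfl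
    | succ n hn ih =>
      have hn' : (1 : ℝ) ≤ n := by exact_mod_cast hN1.trans hn
      have hn0 : (0 : ℝ) < n := by linarith
      obtain ⟨h0, h1, h2⟩ := hv n
      have h := hrec n
      have hg := hN n hn
      rw [h2] at h
      have hu : 0 < (n : ℝ) ^ (-α) := by positivity
      have hgu : (n : ℝ) ^ (1 - α) = n * (n : ℝ) ^ (-α) := by
        rw [sub_eq_add_neg, Real.rpow_add hn0, Real.rpow_one]
      have huv : (n : ℝ) ^ (-α) ≤ ((n : ℝ) + 1) ^ (-α) * (1 + α * (1 / n)) := by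
        have hb : (1 + 1 / (n : ℝ)) ^ α ≤ 1 + α * (1 / n) :=
          rpow_one_add_le_one_add_mul_self
            (by have : (0 : ℝ) ≤ 1 / n := by positivity
                linarith) hα0.le hα1.le
        have he : (n : ℝ) ^ (-α) = ((n : ℝ) + 1) ^ (-α) * (1 + 1 / (n : ℝ)) ^ α := by
          have : 1 + 1 / (n : ℝ) = (n + 1) / n := by field_simp
          rw [this, Real.div_rpow (by positivity) hn0.le, Real.rpow_neg (by positivity),
            Real.rpow_neg (by positivity)]
          have : ((n : ℝ) + 1) ^ α ≠ 0 := by positivity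
          field_simp
        rw [he]
        exact mul_le_mul_of_nonneg_left hb h0.le
      have hvu : ((n : ℝ) + 1) ^ (-α) ≤ (n : ℝ) ^ (-α) :=
        Real.rpow_le_rpow_of_nonpos hn0 (by linarith) (by linarith)
      rw [hgu, div_le_iff₀ hc0] at hg
      push_cast
      set v := ((n : ℝ) + 1) ^ (-α)
      set u := (n : ℝ) ^ (-α)
      have hin : α * (1 / n) ≤ c / 2 * u := by
        rw [mul_one_div, div_le_iff₀ hn0]
        nlinarith
      have hd : u - v ≤ c / 2 * (u * v) := by
        have := mul_le_mul_of_nonneg_left hin h0.le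
        linarith
      have hcv : 0 ≤ 1 - c * v := by
        have := mul_le_one₀ hc1 h0.le h1
        linarith
      have g1 := mul_le_mul_of_nonneg_left ih hcv
      have key : (1 - c * v) * (K * u) + B * v ^ 2 ≤ K * v := by
        have k1 := mul_le_mul_of_nonneg_left hd hK0.le
        have k2 : B * v ^ 2 ≤ B * (u * v) := by
          apply mul_le_mul_of_nonneg_left _ hB
          rw [pow_two]
          exact mul_le_mul_of_nonneg_right hvu h0.le
        have k3 := mul_le_mul_of_nonneg_right hKc (mul_pos hu h0).le
        linarith
      have keyS := mul_le_mul_of_nonneg_right key (add_nonneg ha0 hL)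
      have keyx : B * v * x ≤ K * c * v * x := by
        have : B ≤ K * c := by linarith
        gcongr
      have z : 0 ≤ B * v ^ 2 * a 0 := by positivity
      linarith
  intro n hn
  rcases le_total n N with h | h
  · exact small n hn h
  · exact big n h
end
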